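/- arXiv:1812.08022 — 4 statements merged into one kernel-verified Lean document; each statement's English description precedes it below -/
import Mathlib

section
/- For every block q over a finite alphabet Σ, the set X_q of all q-coverable configurations is a subshift of finite type: there exists a finite set F of patterns such that X_q is exactly the set of configurations in which no pattern of F occurs. -/
open Filter

variable {A : Type*}

/-- The `m × n` block `q` occurs at position `(x, y)` in the configuration `w`:
`w (x+i) (y+j) = q i j` for all `0 ≤ i < m`, `0 ≤ j < n`. -/
def OccursAt (m n : ℕ) (q w : ℤ → ℤ → A) (x y : ℤ) : Prop :=
  ∀ i j : ℤ, 0 ≤ i → i < (m : ℤ) → 0 ≤ j → j < (n : ℤ) → w (x + i) (y + j) = q i j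

/-- The occurrence of the `m × n` block `q` at `(x, y)` in `w` covers position `(p₁, p₂)`. -/
def CoversPos (m n : ℕ) (q w : ℤ → ℤ → A) (x y p₁ p₂ : ℤ) : Prop :=
  OccursAt m n q w x y ∧ x ≤ p₁ ∧ p₁ < x + (m : ℤ) ∧ y ≤ p₂ ∧ p₂ < y + (n : ℤ)

/-- `w` is `q`-coverable: every position of `ℤ²` is covered by an occurrence of `q`. -/
def Coverable (m n : ℕ) (q w : ℤ → ℤ → A) : Prop :=
  ∀ p₁ p₂ : ℤ, ∃ x y : ℤ, CoversPos m n q w x y p₁ p₂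

/-- `Xq m n q` is the set of all `q`-coverable configurations. -/
def Xq (m n : ℕ) (q : ℤ → ℤ → A) : Set (ℤ → ℤ → A) :=
  {w | Coverable m n q w}

/-- A `u × v` block occurring at the bottom-left and top-right corners of the `m × n`
block `q`, different from `q` itself: a border of `q` along the BL/TR diagonal. -/
def IsBorderBLTR (m n u v : ℕ) (q : ℤ → ℤ → A) : Prop :=
  0 < u ∧ u ≤ m ∧ 0 < v ∧ v ≤ n ∧ ¬(u = m ∧ v = n) ∧
    ∀ i j : ℤ, 0 ≤ i → i < (u : ℤ) → 0 ≤ j → j < (v : ℤ) →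
      q i j = q ((m : ℤ) - (u : ℤ) + i) ((n : ℤ) - (v : ℤ) + j)

/-- A `u × v` block occurring at the top-left and bottom-right corners of the `m × n`
block `q`, different from `q` itself: a border of `q` along the TL/BR diagonal. -/
def IsBorderTLBR (m n u v : ℕ) (q : ℤ → ℤ → A) : Prop :=
  0 < u ∧ u ≤ m ∧ 0 < v ∧ v ≤ n ∧ ¬(u = m ∧ v = n) ∧
    ∀ i j : ℤ, 0 ≤ i → i < (u : ℤ) → 0 ≤ j → j < (v : ℤ) →
      q i ((n : ℤ) - (v : ℤ) + j) = q ((m : ℤ) - (u : ℤ) + i) j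

/-- Condition (*): `q` has two borders occurring in (horizontally or vertically)
adjacent corners of `q`, such that these two corner occurrences are neighbouring
fragments.  Since both fragments are restrictions of `q`, they automatically agree
on the intersection of their domains, and the union of the two corner rectangles is
simply connected exactly when they touch or overlap.  A border occurrence at the
top-left corner comes from a TL/BR border `b₁` (sizes `u₁ × v₁`), one at the
vertically adjacent bottom-left corner from a BL/TR border `b₂` (sizes `u₂ × v₂`),
and the two corner rectangles touch or overlap iff `v₁ + v₂ ≥ n`; horizontally
adjacent corners likewise give `u₁ + u₂ ≥ m`, and the remaining two pairs of
adjacent corners give the same two conditions by symmetry. -/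
def StarCond (m n : ℕ) (q : ℤ → ℤ → A) : Prop :=
  ∃ u₁ v₁ u₂ v₂ : ℕ, IsBorderTLBR m n u₁ v₁ q ∧ IsBorderBLTR m n u₂ v₂ q ∧
    (n ≤ v₁ + v₂ ∨ m ≤ u₁ + u₂)

/-- The `u × v` block `q (· % u) (· % v)` is a root of the `m × n` block `q`:
`q` is the concatenation of an `(m/u) × (n/v)` array of copies of it. -/
def IsRoot (m n u v : ℕ) (q : ℤ → ℤ → A) : Prop :=
  0 < u ∧ 0 < v ∧ u ∣ m ∧ v ∣ n ∧
    ∀ i j : ℤ, 0 ≤ i → i < (m : ℤ) → 0 ≤ j → j < (n : ℤ) →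
      q i j = q (i % (u : ℤ)) (j % (v : ℤ))

/-- The `m × n` block `q` is primitive: its only root is itself. -/
def Primitive (m n : ℕ) (q : ℤ → ℤ → A) : Prop :=
  ∀ u v : ℕ, IsRoot m n u v q → u = m ∧ v = n

/-- `(x, y)` is the position of the topmost among the rightmost occurrences of `q`
covering the position `(p₁, p₂)` in `w`. -/
def IsRho (m n : ℕ) (q w : ℤ → ℤ → A) (p₁ p₂ x y : ℤ) : Prop :=
  CoversPos m n q w x y p₁ p₂ ∧
    (∀ x' y' : ℤ, CoversPos m n q w x' y' p₁ p₂ → x' ≤ x) ∧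
    (∀ y' : ℤ, CoversPos m n q w x y' p₁ p₂ → y' ≤ y)

/-- `L_{k,k}(X)`: the set of `k × k` blocks occurring in configurations of `X`. -/
def LangSq (X : Set (ℤ → ℤ → A)) (k : ℕ) : Set (Fin k → Fin k → A) :=
  {b | ∃ w ∈ X, ∃ x y : ℤ, ∀ i j : Fin k, w (x + (i : ℤ)) (y + (j : ℤ)) = b i j}

/-- Topological entropy `h(X) = lim_{k→∞} log₂ |L_{k,k}(X)| / k²` (this limit always
exists, hence coincides with the limsup used here). -/
noncomputable def entropy2D (X : Set (ℤ → ℤ → A)) : ℝ :=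
  Filter.atTop.limsup fun k : ℕ => Real.logb 2 (Nat.card (LangSq X k)) / (k : ℝ) ^ 2

/-- The pattern with domain `D` and colors `p` occurs (up to translation) in `w`. -/
def PatternOccursIn (D : Finset (ℤ × ℤ)) (p : ℤ × ℤ → A) (w : ℤ → ℤ → A) : Prop :=
  ∃ t : ℤ × ℤ, ∀ d ∈ D, w (t.1 + d.1) (t.2 + d.2) = p d

/-- The `m × n` block `q` occurs at `(x, y)` inside the pattern with domain `D` and
colors `p`: the whole occurrence lies in `D`. -/
def PatchOccursAt (m n : ℕ) (q : ℤ → ℤ → A) (D : Finset (ℤ × ℤ)) (p : ℤ × ℤ → A)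
    (x y : ℤ) : Prop :=
  ∀ i j : ℤ, 0 ≤ i → i < (m : ℤ) → 0 ≤ j → j < (n : ℤ) →
    (x + i, y + j) ∈ D ∧ p (x + i, y + j) = q i j

/-- The pattern with domain `D` and colors `p` is `q`-coverable (a `q`-patch):
every position of `D` is covered by an occurrence of `q` inside the pattern. -/
def IsPatch (m n : ℕ) (q : ℤ → ℤ → A) (D : Finset (ℤ × ℤ)) (p : ℤ × ℤ → A) : Prop :=
  ∀ d ∈ D, ∃ x y : ℤ, PatchOccursAt m n q D p x y ∧
    x ≤ d.1 ∧ d.1 < x + (m : ℤ) ∧ y ≤ d.2 ∧ d.2 < y + (n : ℤ)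

/-- An interchangeable pair for `q`: two distinct `q`-patches with the same domain. -/
def InterchangeablePair (m n : ℕ) (q : ℤ → ℤ → A) (D : Finset (ℤ × ℤ))
    (p₁ p₂ : ℤ × ℤ → A) : Prop :=
  IsPatch m n q D p₁ ∧ IsPatch m n q D p₂ ∧ ∃ d ∈ D, p₁ d ≠ p₂ d

/-- `p` lies in the `k × l` rectangle with bottom-left corner `c`. -/
def InRect (c : ℤ × ℤ) (k l : ℕ) (p : ℤ × ℤ) : Prop :=
  c.1 ≤ p.1 ∧ p.1 < c.1 + (k : ℤ) ∧ c.2 ≤ p.2 ∧ p.2 < c.2 + (l : ℤ)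

/-- The pattern with domain `D` and colors `p` occurs in the restriction of `w` to
the `k × l` rectangle with bottom-left corner `c`. -/
def PatternOccursInRect (D : Finset (ℤ × ℤ)) (p : ℤ × ℤ → A) (w : ℤ → ℤ → A)
    (c : ℤ × ℤ) (k l : ℕ) : Prop :=
  ∃ t : ℤ × ℤ, ∀ d ∈ D,
    InRect c k l (t.1 + d.1, t.2 + d.2) ∧ w (t.1 + d.1) (t.2 + d.2) = p d

/-- The window of offsets which decide whether the origin is covered by an `m × n` block. -/
noncomputable def coverWindow (m n : ℕ) : Finset (ℤ × ℤ) :=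
  Finset.Icc (-(m : ℤ)) m ×ˢ Finset.Icc (-(n : ℤ)) n

/-- Whether a position is covered depends only on the window around that position. -/
lemma CoversPos.of_agree_on_coverWindow {A : Type*} {m n : ℕ} {q w w' : ℤ → ℤ → A}
    {s₁ s₂ t₁ t₂ x y : ℤ}
    (h : ∀ d ∈ coverWindow m n, w (s₁ + d.1) (s₂ + d.2) = w' (t₁ + d.1) (t₂ + d.2))
    (hc : CoversPos m n q w (s₁ + x) (s₂ + y) s₁ s₂) :
    CoversPos m n q w' (t₁ + x) (t₂ + y) t₁ t₂ := by
  obtain ⟨ho, h₁, h₂, h₃, h₄⟩ := hc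
  refine ⟨fun i j hi hi' hj hj' => ?_, by omega, by omega, by omega, by omega⟩
  have hd : (x + i, y + j) ∈ coverWindow m n := by
    simp only [coverWindow, Finset.mem_product, Finset.mem_Icc]
    omega
  rw [← ho i j hi hi' hj hj', add_assoc, add_assoc, add_assoc, add_assoc]
  exact (h _ hd).symm

/-- There are finitely many patterns on a fixed domain, up to their values off the domain. -/
lemma finite_patterns_on {A : Type*} [Finite A] (D : Finset (ℤ × ℤ)) (a : A) :
    {P : Finset (ℤ × ℤ) × (ℤ × ℤ → A) | P.1 = D ∧ ∀ d ∉ D, P.2 d = a}.Finite := by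
  classical
  refine (Set.finite_range fun g : D → A =>
    (D, fun d => if h : d ∈ D then g ⟨d, h⟩ else a)).subset ?_
  rintro ⟨D', p⟩ ⟨rfl, hp⟩
  refine ⟨fun d => p d, Prod.ext rfl (funext fun d => ?_)⟩
  by_cases h : d ∈ D'
  · simp [h]
  · simpa [h] using (hp d h).symm

/-- for every block `q`, the set `X_q` of `q`-coverable configurations is
a subshift of finite type: there is a finite set `F` of patterns such that `X_q` is
exactly the set of configurations in which no pattern of `F` occurs. -/
theorem coverable_is_SFT {A : Type*} [Fintype A] (m n : ℕ) (hm : 0 < m) (hn : 0 < n)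
    (q : ℤ → ℤ → A) :
    ∃ F : Set (Finset (ℤ × ℤ) × ((ℤ × ℤ) → A)), F.Finite ∧
      Xq m n q = {w | ∀ P ∈ F, ¬ PatternOccursIn P.1 P.2 w} := by
  classical
  let D := coverWindow m n
  refine ⟨{P | (P.1 = D ∧ ∀ d ∉ D, P.2 d = q 0 0) ∧
    ¬∃ x y, CoversPos m n q (fun i j => P.2 (i, j)) x y 0 0},
    (finite_patterns_on D (q 0 0)).subset fun P hP => hP.1, Set.ext fun w => ⟨?_, ?_⟩⟩
  · rintro hw ⟨_, p⟩ ⟨⟨rfl, -⟩, hp⟩ ⟨t, ht⟩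
    obtain ⟨x, y, hc⟩ := hw t.1 t.2
    refine hp ⟨0 + (x - t.1), 0 + (y - t.2), CoversPos.of_agree_on_coverWindow
      (w := w) (s₁ := t.1) (s₂ := t.2) (fun d hd => ?_) ?_⟩
    · simpa using ht d hd
    · simpa using hc
  · intro hw s₁ s₂
    by_contra hs
    let p : ℤ × ℤ → A := fun d => if d ∈ D then w (s₁ + d.1) (s₂ + d.2) else q 0 0
    refine hw (D, p) ⟨⟨rfl, fun d hd => if_neg hd⟩, ?_⟩
      ⟨(s₁, s₂), fun d hd => (if_pos hd).symm⟩
    rintro ⟨x, y, hc⟩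
    refine hs ⟨s₁ + x, s₂ + y, CoversPos.of_agree_on_coverWindow
      (w := fun i j => p (i, j)) (s₁ := 0) (s₂ := 0) (fun d hd => ?_) ?_⟩
    · simp only [zero_add]
      exact if_pos hd
    · simpa using hc
end

section
/- Let q be a primitive block. If the subshift X_q of q-coverable configurations has strictly positive topological entropy, then q satisfies condition (*). Equivalently, if q does not satisfy condition (*), then h(X_q) = 0. -/
open Filter

variable {A : Type*}

/-- A covering of the plane by translates of an `m × n` rectangle, with positions given by `O`.
Two distinct overlapping translates share a rectangle at most `U₁ × V₁` when the left one is the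
upper one, and at most `U₂ × V₂` when the left one is the lower one. -/
structure RectCover (m n U₁ V₁ U₂ V₂ : ℤ) (O : ℤ → ℤ → Prop) : Prop where
  cov : ∀ p r : ℤ, ∃ x y, O x y ∧ x ≤ p ∧ p < x + m ∧ y ≤ r ∧ r < y + n
  bltr : ∀ x y x' y' : ℤ, O x y → O x' y' → x ≤ x' → x' < x + m → y ≤ y' → y' < y + n →
    (x = x' ∧ y = y') ∨ (x + m - x' ≤ U₂ ∧ y + n - y' ≤ V₂)
  tlbr : ∀ x y x' y' : ℤ, O x y → O x' y' → x ≤ x' → x' < x + m → y' ≤ y → y < y' + n →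
    (x = x' ∧ y = y') ∨ (x + m - x' ≤ U₁ ∧ y' + n - y ≤ V₁)

/-- The overlap bounds of a `RectCover` leave, on each side of a rectangle, a middle part out of
reach of the overlaps. -/
structure SmallOverlap (m n U₁ V₁ U₂ V₂ : ℤ) : Prop where
  m_pos : 0 < m
  n_pos : 0 < n
  U₁_nonneg : 0 ≤ U₁
  V₁_nonneg : 0 ≤ V₁
  U₂_nonneg : 0 ≤ U₂
  V₂_nonneg : 0 ≤ V₂
  width : U₁ + U₂ < m
  height : V₁ + V₂ < n

section RectCover

variable {m n U₁ V₁ U₂ V₂ : ℤ} {O O' : ℤ → ℤ → Prop}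

lemma SmallOverlap.swap (h : SmallOverlap m n U₁ V₁ U₂ V₂) : SmallOverlap m n U₂ V₂ U₁ V₁ := by
  obtain ⟨h1, h2, h3, h4, h5, h6, h7, h8⟩ := h
  constructor <;> omega

lemma RectCover.reflect (h : RectCover m n U₁ V₁ U₂ V₂ O) :
    RectCover m n U₂ V₂ U₁ V₁ (fun x y => O (-x) y) where
  cov p r := by
    obtain ⟨x, y, hO, h1, h2, h3, h4⟩ := h.cov (m - 1 - p) r
    exact ⟨-x, y, by simpa using hO, by omega, by omega, h3, h4⟩
  bltr x y x' y' hO hO' h1 h2 h3 h4 := by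
    have := h.tlbr (-x') y' (-x) y hO' hO (by omega) (by omega) h3 h4
    omega
  tlbr x y x' y' hO hO' h1 h2 h3 h4 := by
    have := h.bltr (-x') y' (-x) y hO' hO (by omega) (by omega) h3 h4
    omega

lemma RectCover.same_row (hs : SmallOverlap m n U₁ V₁ U₂ V₂) (h : RectCover m n U₁ V₁ U₂ V₂ O)
    {x x' y : ℤ} (hx : O x y) (hx' : O x' y) (h1 : x < x') : x + m ≤ x' := by
  obtain ⟨_, _, _, _, _, _, _, _⟩ := hs
  by_contra hc
  have := h.bltr x y x' y hx hx' h1.le (by omega) le_rfl (by omega)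
  omega

lemma RectCover.exists_below (hs : SmallOverlap m n U₁ V₁ U₂ V₂)
    (h : RectCover m n U₁ V₁ U₂ V₂ O) {x y i : ℤ} (hx : O x y) (h1 : U₂ ≤ i) (h2 : i < m - U₁) :
    ∃ p, O p (y - n) ∧ p ≤ x + i ∧ x + i < p + m := by
  obtain ⟨_, _, _, _, _, _, _, _⟩ := hs
  obtain ⟨a, b, hab, h3, h4, h5, h6⟩ := h.cov (x + i) (y - 1)
  obtain rfl | hb : b = y - n ∨ y < b + n := by omega
  · exact ⟨a, hab, h3, h4⟩
  exfalso
  rcases le_or_gt a x with ha | ha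
  · have := h.bltr a b x y hab hx ha (by omega) (by omega) hb
    omega
  · have := h.tlbr x y a b hx hab ha.le (by omega) (by omega) hb
    omega

lemma RectCover.exists_above (hs : SmallOverlap m n U₁ V₁ U₂ V₂)
    (h : RectCover m n U₁ V₁ U₂ V₂ O) {x y i : ℤ} (hx : O x y) (h1 : U₁ ≤ i) (h2 : i < m - U₂) :
    ∃ p, O p (y + n) ∧ p ≤ x + i ∧ x + i < p + m := by
  obtain ⟨_, _, _, _, _, _, _, _⟩ := hs
  obtain ⟨a, b, hab, h3, h4, h5, h6⟩ := h.cov (x + i) (y + n)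
  obtain rfl | hb : b = y + n ∨ b < y + n := by omega
  · exact ⟨a, hab, h3, h4⟩
  exfalso
  rcases le_or_gt a x with ha | ha
  · have := h.tlbr a b x y hab hx ha (by omega) (by omega) hb
    omega
  · have := h.bltr x y a b hx hab ha.le (by omega) (by omega) hb
    omega

/-- If two covers agree below row `c` and contain different overlapping rectangles in row `c`,
the right one being shifted to the right with respect to a rectangle below it, then the
discrepancy propagates to the left. -/
lemma RectCover.left_neighbour (hs : SmallOverlap m n U₁ V₁ U₂ V₂)
    (h : RectCover m n U₁ V₁ U₂ V₂ O) (h' : RectCover m n U₁ V₁ U₂ V₂ O') {c X X' e : ℤ}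
    (hlow : ∀ x y, y < c → (O x y ↔ O' x y)) (hX : O X c) (hX' : O' X' c) (h1 : X' < X)
    (h2 : X < X' + m) (hB : O (X - e) (c - n)) (he : 0 < e) (he' : e < m - U₂) :
    O (X - m) c ∧ ¬ O' (X - m) c ∧ ∃ d, 0 < d ∧ d < m - U₂ ∧ O (X - m - d) (c - n) := by
  have hs' := hs
  obtain ⟨_, _, _, _, _, _, _, _⟩ := hs'
  have hL : O (X - m) c := by
    obtain ⟨a, b, hab, h3, h4, h5, h6⟩ := h.cov (X - 1) c
    have hBL : b < c → a < X - e → c - b ≤ V₁ := fun hb ha => by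
      have := h.tlbr a b (X - e) (c - n) hab hB ha.le (by omega) (by omega) (by omega)
      omega
    obtain ha | rfl : X < a + m ∨ a = X - m := by omega
    · have := h.bltr a b X c hab hX (by omega) ha h5 h6
      have := hBL (by omega) (by omega)
      omega
    · obtain rfl | hb : b = c ∨ b < c := by omega
      · exact hab
      · have := hBL hb (by omega)
        have := h'.bltr (X - m) b X' c ((hlow _ _ hb).1 hab) hX' (by omega) (by omega) h5 h6
        omega
  refine ⟨hL, fun hL' => ?_, ?_⟩
  · have := h'.same_row hs hL' hX' (by omega)
    omega
  · obtain ⟨p, hp, h3, h4⟩ := h.exists_below hs hL le_rfl (by omega)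
    have := h.same_row hs hp hB (by omega)
    exact ⟨X - m - p, by omega, by omega, by simpa using hp⟩

lemma RectCover.left_descent (hs : SmallOverlap m n U₁ V₁ U₂ V₂)
    (h : RectCover m n U₁ V₁ U₂ V₂ O) (h' : RectCover m n U₁ V₁ U₂ V₂ O') {c X e : ℤ}
    (hlow : ∀ x y, y < c → (O x y ↔ O' x y)) (hX : O X c) (hX' : ¬ O' X c)
    (hB : O (X - e) (c - n)) (he : 0 < e) (he' : e < m - U₂) :
    ∃ Y < X, ∃ d, 0 < d ∧ d < m - U₂ ∧ O (Y - d) (c - n) ∧ ¬ (O Y c ↔ O' Y c) := by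
  have hs' := hs
  obtain ⟨_, _, _, _, _, _, _, _⟩ := hs'
  have hlow' : ∀ x, O x (c - n) ↔ O' x (c - n) := fun x => hlow x _ (by omega)
  obtain ⟨X', hX₂, h1, h2⟩ := h'.exists_above hs (i := max U₁ e) ((hlow' _).1 hB)
    (le_max_left _ _) (by omega)
  rw [sub_add_cancel] at hX₂
  rcases lt_trichotomy X X' with hlt | rfl | hlt
  · obtain ⟨h3, h4, d, hd, hd', hd2⟩ := h'.left_neighbour hs h (e := X' - (X - e))
      (fun x y hy => (hlow x y hy).symm) hX₂ hX hlt (by omega)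
      (by simpa using (hlow' _).1 hB) (by omega) (by omega)
    exact ⟨X' - m, by omega, d, hd, hd', (hlow' _).2 hd2, by tauto⟩
  · exact absurd hX₂ hX'
  · obtain ⟨h3, h4, d, hd, hd', hd2⟩ := h.left_neighbour hs h' hlow hX hX₂ hlt (by omega)
      hB he he'
    exact ⟨X - m, by omega, d, hd, hd', hd2, by tauto⟩

lemma RectCover.iff_of_shift_pos (hs : SmallOverlap m n U₁ V₁ U₂ V₂)
    (h : RectCover m n U₁ V₁ U₂ V₂ O) (h' : RectCover m n U₁ V₁ U₂ V₂ O') {c M : ℤ}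
    (hlow : ∀ x y, y < c → (O x y ↔ O' x y)) (hM : ∀ x, x < M → (O x c ↔ O' x c)) {X e : ℤ}
    (hB : O (X - e) (c - n)) (he : 0 < e) (he' : e < m - U₂) : O X c ↔ O' X c := by
  by_contra hne
  obtain ⟨X₀, ⟨d, hd, hd', hdB, hdne⟩, hmin⟩ := Int.exists_least_of_bdd
    (P := fun X => ∃ e, 0 < e ∧ e < m - U₂ ∧ O (X - e) (c - n) ∧ ¬ (O X c ↔ O' X c))
    ⟨M, fun z ⟨_, _, _, _, hz⟩ => by by_contra hlt; exact hz (hM z (by omega))⟩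
    ⟨X, e, he, he', hB, hne⟩
  have hn := hs.n_pos
  have hlow' : ∀ x, O x (c - n) ↔ O' x (c - n) := fun x => hlow x _ (by omega)
  by_cases hX : O X₀ c
  · obtain ⟨Y, hY, d', h1, h2, h3, h4⟩ :=
      h.left_descent hs h' hlow hX (by tauto) hdB hd hd'
    have := hmin Y ⟨d', h1, h2, h3, h4⟩
    omega
  · obtain ⟨Y, hY, d', h1, h2, h3, h4⟩ := h'.left_descent hs h
      (fun x y hy => (hlow x y hy).symm) (by tauto) hX ((hlow' _).1 hdB) hd hd'
    have := hmin Y ⟨d', h1, h2, (hlow' _).2 h3, by tauto⟩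
    omega

lemma RectCover.iff_of_shift_neg (hs : SmallOverlap m n U₁ V₁ U₂ V₂)
    (h : RectCover m n U₁ V₁ U₂ V₂ O) (h' : RectCover m n U₁ V₁ U₂ V₂ O') {c M : ℤ}
    (hlow : ∀ x y, y < c → (O x y ↔ O' x y)) (hM : ∀ x, M < x → (O x c ↔ O' x c)) {X e : ℤ}
    (hB : O (X + e) (c - n)) (he : 0 < e) (he' : e < m - U₁) : O X c ↔ O' X c := by
  have := h.reflect.iff_of_shift_pos (c := c) (M := -M) (X := -X) (e := e) hs.swap h'.reflect
    (fun x y hy => hlow (-x) y hy) (fun x hx => hM (-x) (by omega))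
    (by convert hB using 1; ring) he he'
  simpa using this

lemma RectCover.row_le_of_lowest (hs : SmallOverlap m n U₁ V₁ U₂ V₂)
    (h : RectCover m n U₁ V₁ U₂ V₂ O) (h' : RectCover m n U₁ V₁ U₂ V₂ O') {c M : ℤ}
    (hlow : ∀ x y, y < c → (O x y ↔ O' x y))
    (hM : ∀ x y, ¬ (O x y ↔ O' x y) → -M ≤ x ∧ x ≤ M ∧ -M ≤ y) {X : ℤ} (hX : O X c) :
    O' X c := by
  have hs' := hs
  obtain ⟨_, _, _, _, _, _, _, _⟩ := hs'
  by_contra hX₂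
  have hMl : ∀ x, x < -M → (O x c ↔ O' x c) := fun x hx => by
    by_contra hc
    have := hM x c hc
    omega
  have hMr : ∀ x, M < x → (O x c ↔ O' x c) := fun x hx => by
    by_contra hc
    have := hM x c hc
    omega
  have hpos {X e : ℤ} := h.iff_of_shift_pos hs h' hlow hMl (X := X) (e := e)
  have hneg {X e : ℤ} := h.iff_of_shift_neg hs h' hlow hMr (X := X) (e := e)
  obtain ⟨p, hp, h1, h2⟩ := h.exists_below hs hX le_rfl (by omega)
  obtain ⟨X', hX', h3, h4⟩ := h'.exists_above hs (i := max U₁ (X - p))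
    ((hlow _ _ (by omega)).1 hp) (le_max_left _ _) (by omega)
  rw [sub_add_cancel] at hX'
  rcases lt_trichotomy X X' with hlt | rfl | hlt
  · rcases lt_or_ge p X' with hpX | hpX
    · have := (hpos (X := X') (e := X' - p) (by simpa using hp) (by omega) (by omega)).2 hX'
      have := h.same_row hs hX this hlt
      omega
    · exact hX₂ ((hneg (X := X) (e := p - X) (by simpa using hp) (by omega) (by omega)).1 hX)
  · exact hX₂ hX'
  · rcases lt_or_ge p X with hpX | hpX
    · exact hX₂ ((hpos (X := X) (e := X - p) (by simpa using hp) (by omega) (by omega)).1 hX)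
    · have := (hneg (X := X') (e := p - X') (by simpa using hp) (by omega) (by omega)).2 hX'
      have := h.same_row hs this hX hlt
      omega

/-- Two covers with small overlaps that differ only in a bounded region are equal. -/
lemma RectCover.eq_of_bounded (hs : SmallOverlap m n U₁ V₁ U₂ V₂)
    (h : RectCover m n U₁ V₁ U₂ V₂ O) (h' : RectCover m n U₁ V₁ U₂ V₂ O') {M : ℤ}
    (hM : ∀ x y, ¬ (O x y ↔ O' x y) → -M ≤ x ∧ x ≤ M ∧ -M ≤ y) (x y : ℤ) : O x y ↔ O' x y := by
  by_contra hne
  obtain ⟨c, ⟨X, hX⟩, hmin⟩ := Int.exists_least_of_bdd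
    (P := fun y => ∃ x, ¬ (O x y ↔ O' x y)) ⟨-M, fun z ⟨x, hz⟩ => (hM x z hz).2.2⟩ ⟨y, x, hne⟩
  have hlow : ∀ x y, y < c → (O x y ↔ O' x y) := fun x y hy => by
    by_contra hc
    exact absurd (hmin y ⟨x, hc⟩) (not_le.2 hy)
  exact hX ⟨h.row_le_of_lowest hs h' hlow hM,
    h'.row_le_of_lowest hs h (fun x y hy => (hlow x y hy).symm)
      fun x y hc => hM x y fun hc' => hc hc'.symm⟩

end RectCover

section Blocks

variable {m n : ℕ} {q : ℤ → ℤ → A}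

lemma OccursAt.isBorderBLTR {w : ℤ → ℤ → A} {x y x' y' : ℤ} (h : OccursAt m n q w x y)
    (h' : OccursAt m n q w x' y') (hx : x ≤ x') (hx' : x' < x + m) (hy : y ≤ y')
    (hy' : y' < y + n) (hne : ¬ (x = x' ∧ y = y')) :
    IsBorderBLTR m n (x + m - x').toNat (y + n - y').toNat q := by
  refine ⟨by omega, by omega, by omega, by omega, by omega, fun i j hi hi' hj hj' => ?_⟩
  rw [← h' i j hi (by omega) hj (by omega),
    ← h _ _ (by omega) (by omega) (by omega) (by omega)]
  congr 1 <;> omega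

lemma OccursAt.isBorderTLBR {w : ℤ → ℤ → A} {x y x' y' : ℤ} (h : OccursAt m n q w x y)
    (h' : OccursAt m n q w x' y') (hx : x ≤ x') (hx' : x' < x + m) (hy : y' ≤ y)
    (hy' : y < y' + n) (hne : ¬ (x = x' ∧ y = y')) :
    IsBorderTLBR m n (x + m - x').toNat (y' + n - y).toNat q := by
  refine ⟨by omega, by omega, by omega, by omega, by omega, fun i j hi hi' hj hj' => ?_⟩
  rw [← h' i _ hi (by omega) (by omega) (by omega),
    ← h _ j (by omega) (by omega) hj (by omega)]
  congr 1 <;> omega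

lemma isBorderTLBR_iff_of_full {u v : ℕ} (h : u = m ∨ v = n) :
    IsBorderTLBR m n u v q ↔ IsBorderBLTR m n u v q := by
  unfold IsBorderTLBR IsBorderBLTR
  rcases h with rfl | rfl
  · simp only [sub_self, zero_add, eq_comm]
  · simp only [sub_self, zero_add]

lemma exists_smallOverlap (hm : 0 < m) (hn : 0 < n) (hstar : ¬ StarCond m n q) :
    ∃ U₁ V₁ U₂ V₂ : ℕ, SmallOverlap (m : ℤ) n U₁ V₁ U₂ V₂ ∧
      (∀ u v, IsBorderTLBR m n u v q → u ≤ U₁ ∧ v ≤ V₁) ∧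
      (∀ u v, IsBorderBLTR m n u v q → u ≤ U₂ ∧ v ≤ V₂) := by
  classical
  have hsum : ∀ u₁ v₁ u₂ v₂, IsBorderTLBR m n u₁ v₁ q → IsBorderBLTR m n u₂ v₂ q →
      v₁ + v₂ < n ∧ u₁ + u₂ < m := fun u₁ v₁ u₂ v₂ h1 h2 => by
    by_contra hc
    exact hstar ⟨u₁, v₁, u₂, v₂, h1, h2, by omega⟩
  have hB : ∀ u v, IsBorderBLTR m n u v q → u < m ∧ v < n := fun u v h => by
    have h1 := h.2.1
    have h2 := h.2.2.2.1
    by_contra hc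
    have := hsum u v u v ((isBorderTLBR_iff_of_full (by omega)).2 h) h
    omega
  have hT : ∀ u v, IsBorderTLBR m n u v q → u < m ∧ v < n := fun u v h => by
    have h1 := h.2.1
    have h2 := h.2.2.2.1
    by_contra hc
    have := hsum u v u v h ((isBorderTLBR_iff_of_full (by omega)).1 h)
    omega
  have hmax : ∀ (P : ℕ → Prop) (N : ℕ), (∀ u, P u → u < N) → 0 < N →
      ∃ U, U < N ∧ (U ≠ 0 → P U) ∧ ∀ u, P u → u ≤ U := fun P N hP hN =>
    ⟨Nat.findGreatest P N, by
      rcases Nat.eq_zero_or_pos (Nat.findGreatest P N) with h | h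
      · omega
      · exact hP _ (Nat.findGreatest_of_ne_zero rfl h.ne'),
      fun h => Nat.findGreatest_of_ne_zero rfl h,
      fun u hu => Nat.le_findGreatest (hP u hu).le hu⟩
  obtain ⟨U₁, a1, a2, a3⟩ := hmax (fun u => ∃ v, IsBorderTLBR m n u v q) m
    (fun u ⟨v, h⟩ => (hT u v h).1) hm
  obtain ⟨V₁, b1, b2, b3⟩ := hmax (fun v => ∃ u, IsBorderTLBR m n u v q) n
    (fun v ⟨u, h⟩ => (hT u v h).2) hn
  obtain ⟨U₂, c1, c2, c3⟩ := hmax (fun u => ∃ v, IsBorderBLTR m n u v q) m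
    (fun u ⟨v, h⟩ => (hB u v h).1) hm
  obtain ⟨V₂, d1, d2, d3⟩ := hmax (fun v => ∃ u, IsBorderBLTR m n u v q) n
    (fun v ⟨u, h⟩ => (hB u v h).2) hn
  have hU : U₁ + U₂ < m := by
    by_cases h1 : U₁ = 0
    · omega
    by_cases h2 : U₂ = 0
    · omega
    obtain ⟨v₁, h1⟩ := a2 h1
    obtain ⟨v₂, h2⟩ := c2 h2
    exact (hsum _ _ _ _ h1 h2).2
  have hV : V₁ + V₂ < n := by
    by_cases h1 : V₁ = 0
    · omega
    by_cases h2 : V₂ = 0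
    · omega
    obtain ⟨u₁, h1⟩ := b2 h1
    obtain ⟨u₂, h2⟩ := d2 h2
    exact (hsum _ _ _ _ h1 h2).1
  exact ⟨U₁, V₁, U₂, V₂, by constructor <;> omega,
    fun u v h => ⟨a3 u ⟨v, h⟩, b3 v ⟨u, h⟩⟩, fun u v h => ⟨c3 u ⟨v, h⟩, d3 v ⟨u, h⟩⟩⟩

lemma Coverable.rectCover {U₁ V₁ U₂ V₂ : ℕ}
    (hT : ∀ u v, IsBorderTLBR m n u v q → u ≤ U₁ ∧ v ≤ V₁)
    (hB : ∀ u v, IsBorderBLTR m n u v q → u ≤ U₂ ∧ v ≤ V₂) {w : ℤ → ℤ → A}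
    (hw : Coverable m n q w) : RectCover (m : ℤ) n U₁ V₁ U₂ V₂ (OccursAt m n q w) where
  cov := hw
  bltr x y x' y' h h' h1 h2 h3 h4 := by
    by_cases hne : x = x' ∧ y = y'
    · exact Or.inl hne
    · have := hB _ _ (h.isBorderBLTR h' h1 h2 h3 h4 hne)
      omega
  tlbr x y x' y' h h' h1 h2 h3 h4 := by
    by_cases hne : x = x' ∧ y = y'
    · exact Or.inl hne
    · have := hT _ _ (h.isBorderTLBR h' h1 h2 h3 h4 hne)
      omega

lemma Coverable.apply_eq_of_occursAt_iff {w w' : ℤ → ℤ → A} (hw : Coverable m n q w)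
    (h : ∀ x y, OccursAt m n q w x y ↔ OccursAt m n q w' x y) (x y : ℤ) : w x y = w' x y := by
  obtain ⟨a, b, hab, h1, h2, h3, h4⟩ := hw x y
  have e1 := hab (x - a) (y - b) (by omega) (by omega) (by omega) (by omega)
  have e2 := (h a b).1 hab (x - a) (y - b) (by omega) (by omega) (by omega) (by omega)
  simpa using e1.trans e2.symm

lemma OccursAt.congr {w w' : ℤ → ℤ → A} {x y : ℤ} (h : OccursAt m n q w x y)
    (heq : ∀ a b, x ≤ a → a < x + m → y ≤ b → b < y + n → w a b = w' a b) :
    OccursAt m n q w' x y := fun i j hi hi' hj hj' => by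
  rw [← heq _ _ (by omega) (by omega) (by omega) (by omega)]
  exact h i j hi hi' hj hj'

/-- If `q` does not satisfy condition (*), coverable configurations that differ only in a bounded
region are equal. -/
lemma Coverable.eq_of_eq_outside (hm : 0 < m) (hn : 0 < n) (hstar : ¬ StarCond m n q)
    {w w' : ℤ → ℤ → A} (hw : Coverable m n q w) (hw' : Coverable m n q w') {k : ℕ}
    (h : ∀ x y : ℤ, ¬ (0 ≤ x ∧ x < k ∧ 0 ≤ y ∧ y < k) → w x y = w' x y) (x y : ℤ) :
    w x y = w' x y := by
  obtain ⟨U₁, V₁, U₂, V₂, hs, hT, hB⟩ := exists_smallOverlap hm hn hstar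
  refine hw.apply_eq_of_occursAt_iff
    ((hw.rectCover hT hB).eq_of_bounded hs (hw'.rectCover hT hB) (M := k + m + n) ?_) x y
  intro a b hne
  by_contra hc
  refine hne ⟨fun ho => ho.congr fun x y _ _ _ _ => h x y (by omega),
    fun ho => ho.congr fun x y _ _ _ _ => (h x y (by omega)).symm⟩

/-- Replacing a square of a coverable configuration by that of another one which agrees with it on
a sufficiently thick frame of the square yields a coverable configuration. -/
lemma Coverable.glue {w w' : ℤ → ℤ → A} (hw : Coverable m n q w) (hw' : Coverable m n q w')
    {k c : ℕ} (hc : 2 * (m + n) ≤ c)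
    (h : ∀ x y : ℤ, 0 ≤ x → x < k → 0 ≤ y → y < k →
      (x < c ∨ (k : ℤ) - c ≤ x ∨ y < c ∨ (k : ℤ) - c ≤ y) → w x y = w' x y) :
    Coverable m n q
      (fun x y => if 0 ≤ x ∧ x < k ∧ 0 ≤ y ∧ y < k then w x y else w' x y) := by
  intro p r
  by_cases hin : (m + n : ℤ) ≤ p ∧ p < k - (m + n) ∧ (m + n : ℤ) ≤ r ∧ r < k - (m + n)
  · obtain ⟨x, y, ho, h1, h2, h3, h4⟩ := hw p r
    exact ⟨x, y, ho.congr fun a b _ _ _ _ => by rw [if_pos (by omega)], h1, h2, h3, h4⟩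
  · obtain ⟨x, y, ho, h1, h2, h3, h4⟩ := hw' p r
    refine ⟨x, y, ho.congr fun a b _ _ _ _ => ?_, h1, h2, h3, h4⟩
    split_ifs with hsq
    · exact (h a b (by omega) (by omega) (by omega) (by omega) (by omega)).symm
    · rfl

lemma Coverable.eq_on_square_of_frame (hm : 0 < m) (hn : 0 < n) (hstar : ¬ StarCond m n q)
    {w w' : ℤ → ℤ → A} (hw : Coverable m n q w) (hw' : Coverable m n q w') {k c : ℕ}
    (hc : 2 * (m + n) ≤ c)
    (h : ∀ x y : ℤ, 0 ≤ x → x < k → 0 ≤ y → y < k →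
      (x < c ∨ (k : ℤ) - c ≤ x ∨ y < c ∨ (k : ℤ) - c ≤ y) → w x y = w' x y)
    {x y : ℤ} (hx : 0 ≤ x) (hx' : x < k) (hy : 0 ≤ y) (hy' : y < k) : w x y = w' x y := by
  have := (hw.glue hw' hc h).eq_of_eq_outside hm hn hstar hw' (k := k)
    (fun x y hxy => if_neg hxy) x y
  rwa [if_pos ⟨hx, hx', hy, hy'⟩] at this

lemma Coverable.translate {w : ℤ → ℤ → A} (hw : Coverable m n q w) (s t : ℤ) :
    Coverable m n q (fun x y => w (s + x) (t + y)) := fun p r => by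
  obtain ⟨x, y, ho, h1, h2, h3, h4⟩ := hw (s + p) (t + r)
  refine ⟨x - s, y - t, fun i j hi hi' hj hj' => ?_, by omega, by omega, by omega, by omega⟩
  rw [← ho i j hi hi' hj hj']
  simp only [add_sub_cancel, ← add_assoc]

lemma exists_coverable_of_mem_langSq {k : ℕ} (b : LangSq (Xq m n q) k) :
    ∃ w, Coverable m n q w ∧ ∀ i j : Fin k, w i j = b.1 i j := by
  obtain ⟨b, w, hw, x, y, h⟩ := b
  exact ⟨_, Coverable.translate hw x y, h⟩

lemma card_langSq_le [Fintype A] (hm : 0 < m) (hn : 0 < n) (hstar : ¬ StarCond m n q) (k : ℕ) :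
    Nat.card (LangSq (Xq m n q) k) ≤ Fintype.card A ^ (8 * (m + n) * k) := by
  choose W hW hWb using exists_coverable_of_mem_langSq (m := m) (n := n) (q := q) (k := k)
  let c := 2 * (m + n)
  let F : LangSq (Xq m n q) k → (Fin c × Fin k → A) × (Fin c × Fin k → A) ×
      (Fin c × Fin k → A) × (Fin c × Fin k → A) := fun b =>
    (fun s => W b s.1 s.2, fun s => W b (k - c + s.1) s.2,
      fun s => W b s.2 s.1, fun s => W b s.2 (k - c + s.1))
  have hF : Function.Injective F := by
    intro b b' hbb
    simp only [F, Prod.mk.injEq] at hbb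
    obtain ⟨e1, e2, e3, e4⟩ := hbb
    have hfin : ∀ (N : ℕ) (z : ℤ), 0 ≤ z → z < N → ∃ i : Fin N, (i : ℤ) = z :=
      fun N z h0 h1 => ⟨⟨z.toNat, by omega⟩, by simpa using h0⟩
    have hframe : ∀ x y : ℤ, 0 ≤ x → x < k → 0 ≤ y → y < k →
        (x < c ∨ (k : ℤ) - c ≤ x ∨ y < c ∨ (k : ℤ) - c ≤ y) → W b x y = W b' x y := by
      intro x y hx hx' hy hy' hxy
      obtain ⟨i, rfl⟩ := hfin k x hx hx'
      obtain ⟨j, rfl⟩ := hfin k y hy hy'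
      rcases hxy with h | h | h | h
      · obtain ⟨s, hs⟩ := hfin c _ hx h
        simpa [hs] using congrFun e1 (s, j)
      · obtain ⟨s, hs⟩ := hfin c ((i : ℤ) - (k - c)) (by omega) (by omega)
        simpa [hs] using congrFun e2 (s, j)
      · obtain ⟨s, hs⟩ := hfin c _ hy h
        simpa [hs] using congrFun e3 (s, i)
      · obtain ⟨s, hs⟩ := hfin c ((j : ℤ) - (k - c)) (by omega) (by omega)
        simpa [hs] using congrFun e4 (s, i)
    apply Subtype.ext
    funext i j
    rw [← hWb b i j, ← hWb b' i j]
    exact (hW b).eq_on_square_of_frame hm hn hstar (hW b') le_rfl hframe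
      (by omega) (by omega) (by omega) (by omega)
  refine (Nat.card_le_card_of_injective F hF).trans (le_of_eq ?_)
  simp only [Nat.card_prod, Nat.card_fun, Nat.card_fin, c]
  rw [Nat.card_eq_fintype_card]
  ring

end Blocks

lemma entropy2D_eq_zero_of_card_le {X : Set (ℤ → ℤ → A)} {a d : ℕ}
    (h : ∀ k, Nat.card (LangSq X k) ≤ a ^ (d * k)) : entropy2D X = 0 := by
  apply Tendsto.limsup_eq
  have hlim : Tendsto (fun k : ℕ => (d * Real.logb 2 (a + 1)) / (k : ℝ)) atTop (nhds 0) :=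
    tendsto_const_div_atTop_nhds_zero_nat _
  refine squeeze_zero (fun k => ?_) (fun k => ?_) hlim
  · refine div_nonneg ?_ (by positivity)
    rcases Nat.eq_zero_or_pos (Nat.card (LangSq X k)) with h0 | h0
    · simp [h0]
    · exact Real.logb_nonneg one_lt_two (by exact_mod_cast h0)
  · rcases Nat.eq_zero_or_pos k with rfl | hk
    · simp
    have hk' : (0 : ℝ) < k := by exact_mod_cast hk
    have ha : (0 : ℝ) ≤ Real.logb 2 (a + 1) :=
      Real.logb_nonneg one_lt_two (by linarith [Nat.cast_nonneg (α := ℝ) a])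
    have hlog : Real.logb 2 (Nat.card (LangSq X k)) ≤ d * k * Real.logb 2 (a + 1) := by
      rcases Nat.eq_zero_or_pos (Nat.card (LangSq X k)) with h0 | h0
      · rw [h0, Nat.cast_zero, Real.logb_zero]
        positivity
      · have hle : (Nat.card (LangSq X k) : ℝ) ≤ ((a : ℝ) + 1) ^ (d * k) := by
          exact_mod_cast (h k).trans (Nat.pow_le_pow_left a.le_succ _)
        refine (Real.logb_le_logb_of_le one_lt_two (by exact_mod_cast h0) hle).trans ?_
        rw [Real.logb_pow]
        push_cast
        exact le_rfl
    rw [div_le_div_iff₀ (by positivity) hk']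
    calc _ ≤ d * k * Real.logb 2 (a + 1) * k := by gcongr
      _ = _ := by ring

/-- if `q` is a primitive block and the subshift `X_q` has strictly
positive topological entropy, then `q` satisfies condition (*). -/
theorem starCond_of_pos_entropy {A : Type*} [Fintype A] (m n : ℕ)
    (hm : 0 < m) (hn : 0 < n) (q : ℤ → ℤ → A) (hq : Primitive m n q)
    (hpos : 0 < entropy2D (Xq m n q)) :
    StarCond m n q := by
  by_contra hstar
  exact hpos.ne' (entropy2D_eq_zero_of_card_le (card_langSq_le hm hn hstar))
end

section
/- Let q be a block that does not satisfy condition (*), let w be a q-coverable configuration, and let p ∈ ℤ² be a position. Then among all occurrences of q in w that cover p, there is exactly one whose x-coordinate is maximal (the rightmost occurrence of q covering p is unique). -/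
open Filter

variable {A : Type*}

/-- Two distinct occurrences of `q` in the same columns that share a row give `q` a full-width
border along both diagonals, so condition (*) holds. -/
theorem starCond_of_occursAt_of_lt {A : Type*} {m n : ℕ} (hm : 0 < m) {q w : ℤ → ℤ → A}
    {x y y' : ℤ} (h : OccursAt m n q w x y) (h' : OccursAt m n q w x y')
    (hlt : y < y') (hov : y' < y + n) : StarCond m n q := by
  obtain ⟨v, hv⟩ : ∃ v : ℕ, (v : ℤ) = n - (y' - y) := ⟨_, Int.toNat_of_nonneg (by omega)⟩
  have key : ∀ i j : ℤ, 0 ≤ i → i < (m : ℤ) → 0 ≤ j → j < (v : ℤ) →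
      q i j = q i ((n : ℤ) - v + j) := fun i j hi him hj hjv => by
    rw [← h' i j hi him hj (by omega), ← h i (n - v + j) hi him (by omega) (by omega)]
    congr 1
    omega
  refine ⟨m, v, m, v, ⟨hm, le_rfl, by omega, by omega, by omega, ?_⟩,
    ⟨hm, le_rfl, by omega, by omega, by omega, ?_⟩, Or.inr (by omega)⟩
  · intro i j hi him hj hjv
    simpa using (key i j hi him hj hjv).symm
  · intro i j hi him hj hjv
    simpa using key i j hi him hj hjv

/-- if `q` does not satisfy condition (*) and `w` is a `q`-coverable
configuration, then for every position `(p₁, p₂)` there is exactly one occurrence of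
`q` in `w` covering `(p₁, p₂)` whose x-coordinate is maximal among such occurrences. -/
theorem rightmost_occurrence_unique {A : Type*} (m n : ℕ) (hm : 0 < m) (hn : 0 < n)
    (q : ℤ → ℤ → A) (hstar : ¬ StarCond m n q)
    (w : ℤ → ℤ → A) (hw : Coverable m n q w) (p₁ p₂ : ℤ) :
    ∃! r : ℤ × ℤ, CoversPos m n q w r.1 r.2 p₁ p₂ ∧
      ∀ x' y' : ℤ, CoversPos m n q w x' y' p₁ p₂ → x' ≤ r.1 := by
  obtain ⟨x₀, hx₀⟩ := hw p₁ p₂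
  obtain ⟨x, ⟨y, hxy⟩, hmax⟩ := Int.exists_greatest_of_bdd
    (P := fun x => ∃ y, CoversPos m n q w x y p₁ p₂)
    ⟨p₁, fun _ ⟨_, h⟩ => h.2.1⟩ ⟨x₀, hx₀⟩
  refine ⟨(x, y), ⟨hxy, fun x' y' h => hmax x' ⟨y', h⟩⟩, ?_⟩
  rintro ⟨x', y'⟩ ⟨h, h_max⟩
  obtain rfl : x' = x := le_antisymm (hmax x' ⟨y', h⟩) (h_max x y hxy)
  obtain ⟨ho, -, -, hy₁, hy₂⟩ := hxy
  obtain ⟨ho', -, -, hy₁', hy₂'⟩ := h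
  dsimp only at ho' hy₁' hy₂'
  rcases lt_trichotomy y y' with hlt | rfl | hlt
  · exact absurd (starCond_of_occursAt_of_lt hm ho ho' hlt (by omega)) hstar
  · rfl
  · exact absurd (starCond_of_occursAt_of_lt hm ho' ho hlt (by omega)) hstar
end

section
/- Every nonprimitive block q satisfies condition (*). (Indeed, writing q = r^{a×b} with (a,b) ≠ (1,1), the block q has a full-width or a full-height border.) -/
open Filter

variable {A : Type*}

/-- The last `u` columns of a block with a `u × v` root repeat its first `u` columns. -/
theorem IsRoot.eq_shift_left {A : Type*} {m n u v : ℕ} {q : ℤ → ℤ → A}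
    (h : IsRoot m n u v q) {i j : ℤ} (hi : 0 ≤ i) (hiu : i < u) (hj : 0 ≤ j) (hjn : j < n)
    (hum : u ≤ m) : q i j = q ((m : ℤ) - u + i) j := by
  obtain ⟨-, -, hu, -, hq⟩ := h
  have hmod : ((m : ℤ) - u + i) % u = i % u :=
    Int.ModEq.symm <| Int.modEq_iff_dvd.2 <| by
      simpa using dvd_sub (Int.natCast_dvd_natCast.2 hu) (dvd_refl (u : ℤ))
  rw [hq i j hi (by omega) hj hjn, hq _ j (by omega) (by omega) hj hjn, hmod]

/-- The last `v` rows of a block with a `u × v` root repeat its first `v` rows. -/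
theorem IsRoot.eq_shift_right {A : Type*} {m n u v : ℕ} {q : ℤ → ℤ → A}
    (h : IsRoot m n u v q) {i j : ℤ} (hi : 0 ≤ i) (him : i < m) (hj : 0 ≤ j) (hjv : j < v)
    (hvn : v ≤ n) : q i j = q i ((n : ℤ) - v + j) := by
  obtain ⟨hu, hv, hum, hvn', hq⟩ := h
  have hroot : IsRoot n m v u fun x y => q y x :=
    ⟨hv, hu, hvn', hum, fun x y hx hxn hy hym => hq y x hy hym hx hxn⟩
  exact hroot.eq_shift_left hj hjv hi him hvn

/-- every nonprimitive block satisfies condition (*). -/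
theorem starCond_of_nonprimitive {A : Type*} (m n : ℕ) (hm : 0 < m) (hn : 0 < n)
    (q : ℤ → ℤ → A) (h : ¬ Primitive m n q) :
    StarCond m n q := by
  simp only [Primitive, not_forall] at h
  obtain ⟨u, v, hroot, hne⟩ := h
  have hum : u ≤ m := Nat.le_of_dvd hm hroot.2.2.1
  have hvn : v ≤ n := Nat.le_of_dvd hn hroot.2.2.2.1
  by_cases hu : u = m
  · have hv : v ≠ n := fun hv => hne ⟨hu, hv⟩
    refine ⟨m, v, m, v, ⟨hm, le_rfl, hroot.2.1, hvn, by tauto, fun i j hi hi' hj hj' => ?_⟩,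
      ⟨hm, le_rfl, hroot.2.1, hvn, by tauto, fun i j hi hi' hj hj' => ?_⟩, .inr (by omega)⟩
    · simpa using (hroot.eq_shift_right hi hi' hj hj' hvn).symm
    · simpa using hroot.eq_shift_right hi hi' hj hj' hvn
  · refine ⟨u, n, u, n, ⟨hroot.1, hum, hn, le_rfl, by tauto, fun i j hi hi' hj hj' => ?_⟩,
      ⟨hroot.1, hum, hn, le_rfl, by tauto, fun i j hi hi' hj hj' => ?_⟩, .inl (by omega)⟩ <;>
    simpa using hroot.eq_shift_left hi hi' hj hj' hum
end
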